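/- arXiv:1212.5098 — 5 statements merged into one kernel-verified Lean document; each statement's English description precedes it below -/
import Mathlib

section
/- Let P ⊆ M be finite subsets of ℝ^d, let q ∈ M \ P be a Steiner point whose (unweighted) Voronoi cell Vor_M(q) is bounded, and let p ∈ P. If t > sup_{x ∈ Vor_M(q)} ‖p − x‖², then the weighted Voronoi cell of q at time t is empty: there is no x ∈ ℝ^d with π_q(x,t) ≤ π_m(x,t) for all m ∈ M. -/
open scoped Classical

/-- The (unweighted) Voronoi cell of `q` with respect to the site set `S`. -/
noncomputable def vorCell (d : ℕ) (S : Set (EuclideanSpace ℝ (Fin d)))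
    (q : EuclideanSpace ℝ (Fin d)) : Set (EuclideanSpace ℝ (Fin d)) :=
  {x | ∀ m ∈ S, ‖x - q‖ ≤ ‖x - m‖}

/-- The power distance at time `t` from `x` to a site `m`: input points `m ∈ P`
have squared weight `t`, Steiner points have weight `0`. -/
noncomputable def powDist (d : ℕ) (P : Set (EuclideanSpace ℝ (Fin d)))
    (m x : EuclideanSpace ℝ (Fin d)) (t : ℝ) : ℝ :=
  if m ∈ P then ‖x - m‖ ^ 2 - t else ‖x - m‖ ^ 2

/-- The weighted Voronoi cell of `q ∈ M` at time `t`. -/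
noncomputable def wVorCell (d : ℕ) (P M : Set (EuclideanSpace ℝ (Fin d)))
    (q : EuclideanSpace ℝ (Fin d)) (t : ℝ) : Set (EuclideanSpace ℝ (Fin d)) :=
  {x | ∀ m ∈ M, powDist d P q x t ≤ powDist d P m x t}

theorem steiner_cell_empty_after_time (d : ℕ) (hd : 0 < d)
    (P M : Set (EuclideanSpace ℝ (Fin d)))
    (hPfin : P.Finite) (hMfin : M.Finite) (hPM : P ⊆ M)
    (q : EuclideanSpace ℝ (Fin d)) (hq : q ∈ M \ P)
    (hbd : Bornology.IsBounded (vorCell d M q))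
    (p : EuclideanSpace ℝ (Fin d)) (hp : p ∈ P)
    (t : ℝ) (ht : sSup ((fun x => ‖p - x‖ ^ 2) '' vorCell d M q) < t) :
    wVorCell d P M q t = ∅ := by
  have ht0 : 0 ≤ t := by
    refine le_trans (Real.sSup_nonneg ?_) ht.le
    rintro _ ⟨x, _, rfl⟩
    positivity
  have hbdd : BddAbove ((fun x => ‖p - x‖ ^ 2) '' vorCell d M q) := by
    obtain ⟨R, hR⟩ := hbd.subset_closedBall p
    refine ⟨R ^ 2, ?_⟩
    rintro _ ⟨x, hx, rfl⟩
    have h := hR hx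
    rw [Metric.mem_closedBall, dist_comm, dist_eq_norm] at h
    exact pow_le_pow_left₀ (norm_nonneg _) h 2
  rw [Set.eq_empty_iff_forall_notMem]
  intro x hx
  have hxV : x ∈ vorCell d M q := by
    intro m hm
    have h := hx m hm
    unfold powDist at h
    rw [if_neg hq.2] at h
    refine (sq_le_sq₀ (norm_nonneg _) (norm_nonneg _)).1 ?_
    split_ifs at h <;> linarith
  have h1 := le_csSup hbdd (Set.mem_image_of_mem _ hxV)
  have h2 := hx p (hPM hp)
  unfold powDist at h2
  rw [if_neg hq.2, if_pos hp, norm_sub_rev x p] at h2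
  have h3 := sq_nonneg ‖x - q‖
  linarith
end

section
/- Let P ⊆ M be finite subsets of ℝ^d with P nonempty, and suppose that for every q ∈ M \ P the (unweighted) Voronoi cell Vor_M(q) is bounded. Then there exists a time t* ≥ 0 such that for all t ≥ t* and every q ∈ M \ P, the weighted Voronoi cell of q at time t is empty. -/
open scoped Classical

theorem exists_time_all_steiner_cells_empty (d : ℕ) (hd : 0 < d)
    (P M : Set (EuclideanSpace ℝ (Fin d)))
    (hPfin : P.Finite) (hMfin : M.Finite) (hPM : P ⊆ M) (hPne : P.Nonempty)
    (hbd : ∀ q ∈ M \ P, Bornology.IsBounded (vorCell d M q)) :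
    ∃ tstar : ℝ, 0 ≤ tstar ∧ ∀ t ≥ tstar, ∀ q ∈ M \ P, wVorCell d P M q t = ∅ := by
  obtain ⟨p, hp⟩ := hPne
  have hU : Bornology.IsBounded (⋃ q ∈ M \ P, vorCell d M q) :=
    (Bornology.isBounded_biUnion (hMfin.subset Set.diff_subset)).2 hbd
  obtain ⟨R, hR⟩ := hU.subset_closedBall p
  refine ⟨R ^ 2 + 1, by positivity, ?_⟩
  intro t ht q hq
  rw [Set.eq_empty_iff_forall_notMem]
  intro x hx
  have ht0 : 0 ≤ t := le_trans (by positivity) ht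
  have hcell : x ∈ vorCell d M q := by
    intro m hm
    have h := hx m hm
    unfold powDist at h
    rw [if_neg hq.2] at h
    refine (sq_le_sq₀ (norm_nonneg _) (norm_nonneg _)).1 ?_
    split_ifs at h <;> linarith
  have hxR : ‖x - p‖ ≤ R := by
    have := hR (Set.mem_biUnion hq hcell)
    rwa [Metric.mem_closedBall, dist_eq_norm] at this
  have h := hx p (hPM hp)
  unfold powDist at h
  rw [if_neg hq.2, if_pos hp] at h
  have h1 : ‖x - p‖ ^ 2 ≤ R ^ 2 := pow_le_pow_left₀ (norm_nonneg _) hxR 2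
  have h2 := sq_nonneg ‖x - q‖
  linarith
end

section
/- Let γ > 0, let p ∈ ℝ^d, let i be an integer, and let A ⊆ ℝ^d be a finite set of points such that every q ∈ A satisfies (1+γ)^{i−1} ≤ ‖p − q‖ ≤ (1+γ)^i, and such that the open balls B(q, γ‖p − q‖), for q ∈ A, are pairwise disjoint. Then the cardinality of A is at most (1+γ)^{2d} / γ^d. -/
theorem shell_packing_bound (d : ℕ) (hd : 0 < d) (γ : ℝ) (hγ : 0 < γ)
    (p : EuclideanSpace ℝ (Fin d)) (i : ℤ)
    (A : Set (EuclideanSpace ℝ (Fin d))) (hAfin : A.Finite)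
    (hshell : ∀ q ∈ A, (1 + γ) ^ (i - 1) ≤ ‖p - q‖ ∧ ‖p - q‖ ≤ (1 + γ) ^ i)
    (hdisj : A.Pairwise fun q q' =>
      Disjoint (Metric.ball q (γ * ‖p - q‖)) (Metric.ball q' (γ * ‖p - q'‖))) :
    (A.ncard : ℝ) ≤ (1 + γ) ^ (2 * d) / γ ^ d := by
  have h1 : (0 : ℝ) < 1 + γ := by linarith
  set s : ℝ := (1 + γ) ^ (i - 1) with hs
  have hs0 : 0 < s := zpow_pos h1 _
  have hsi : (1 + γ) ^ i = s * (1 + γ) := by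
    rw [hs, ← zpow_add_one₀ h1.ne']; simp
  set μ : MeasureTheory.Measure (EuclideanSpace ℝ (Fin d)) := MeasureTheory.volume with hμ
  have hdisj' : (↑hAfin.toFinset : Set _).PairwiseDisjoint
      (fun q : EuclideanSpace ℝ (Fin d) => Metric.ball q (γ * s)) := by
    intro q hq q' hq' hne
    have hq1 : q ∈ A := by simpa using hq
    have hq2 : q' ∈ A := by simpa using hq'
    refine (hdisj hq1 hq2 hne).mono ?_ ?_
    · exact Metric.ball_subset_ball (mul_le_mul_of_nonneg_left (hshell q hq1).1 hγ.le)
    · exact Metric.ball_subset_ball (mul_le_mul_of_nonneg_left (hshell q' hq2).1 hγ.le)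
  have hsub : (⋃ q ∈ hAfin.toFinset, Metric.ball q (γ * s)) ⊆
      Metric.ball p (s * (1 + γ) ^ 2) := by
    refine Set.iUnion₂_subset fun q hq => Metric.ball_subset_ball' ?_
    have hq1 : q ∈ A := by simpa using hq
    have h2 := (hshell q hq1).2
    rw [hsi, ← dist_eq_norm, dist_comm] at h2
    nlinarith [mul_pos hγ hs0, mul_pos hγ (mul_pos hγ hs0)]
  have hle := MeasureTheory.measure_mono (μ := μ) hsub
  rw [MeasureTheory.measure_biUnion_finset hdisj' (fun _ _ => measurableSet_ball)] at hle
  have hr : 0 ≤ s * (1 + γ) ^ 2 := by positivity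
  have hr' : 0 ≤ γ * s := by positivity
  have : Nonempty (Fin d) := ⟨⟨0, hd⟩⟩
  simp only [MeasureTheory.Measure.addHaar_ball μ _ hr, MeasureTheory.Measure.addHaar_ball μ _ hr',
    finrank_euclideanSpace, Fintype.card_fin, Finset.sum_const, nsmul_eq_mul] at hle
  have hb0 : μ (Metric.ball 0 1) ≠ 0 := (Metric.measure_ball_pos μ _ one_pos).ne'
  have hbt : μ (Metric.ball 0 1) ≠ ⊤ := MeasureTheory.measure_ball_lt_top.ne
  rw [← mul_assoc, ENNReal.mul_le_mul_iff_left hb0 hbt, ← ENNReal.ofReal_natCast,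
    ← ENNReal.ofReal_mul (by positivity), ENNReal.ofReal_le_ofReal_iff (by positivity),
    ← Set.ncard_eq_toFinset_card A hAfin, mul_pow, mul_pow, ← pow_mul] at hle
  rw [le_div_iff₀ (by positivity)]
  have hsd : 0 < s ^ d := by positivity
  refine le_of_mul_le_mul_right ?_ hsd
  linarith
end

section
/- Let p_1, …, p_{d+2} be points in ℝ^d. Then the (d+2)×(d+2) determinant whose i-th column consists of the d coordinates of p_i, followed by ‖p_i‖², followed by 1, is zero if and only if the points p_1, …, p_{d+2} lie on a common sphere (there exist c ∈ ℝ^d and r ≥ 0 with ‖p_i − c‖ = r for all i) or on a common affine hyperplane of ℝ^d. -/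
open scoped RealInnerProductSpace

/-- The `(d+2) × (d+2)` matrix whose `j`-th column consists of the `d`
coordinates of `p j`, followed by `‖p j‖²`, followed by `1`. -/
noncomputable def inSphereMatrix (d : ℕ) (p : Fin (d + 2) → EuclideanSpace ℝ (Fin d)) :
    Matrix (Fin (d + 2)) (Fin (d + 2)) ℝ :=
  Matrix.of fun i j =>
    if h : (i : ℕ) < d then p j ⟨(i : ℕ), h⟩
    else if (i : ℕ) = d then ‖p j‖ ^ 2
    else 1

lemma vecMul_inSphereMatrix (d : ℕ) (p : Fin (d + 2) → EuclideanSpace ℝ (Fin d))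
    (v : Fin (d + 2) → ℝ) (j : Fin (d + 2)) :
    Matrix.vecMul v (inSphereMatrix d p) j =
      ⟪(WithLp.toLp 2 (fun i : Fin d => v i.castSucc.castSucc) : EuclideanSpace ℝ (Fin d)), p j⟫
        + v (Fin.last d).castSucc * ‖p j‖ ^ 2 + v (Fin.last (d + 1)) := by
  simp only [Matrix.vecMul, dotProduct, Fin.sum_univ_castSucc, PiLp.inner_apply]
  simp [inSphereMatrix, mul_comm]

theorem det_eq_zero_iff_cospherical_or_cohyperplanar (d : ℕ) (hd : 0 < d)
    (p : Fin (d + 2) → EuclideanSpace ℝ (Fin d)) :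
    (inSphereMatrix d p).det = 0 ↔
      ((∃ (c : EuclideanSpace ℝ (Fin d)) (r : ℝ), 0 ≤ r ∧ ∀ i, ‖p i - c‖ = r) ∨
       (∃ (a : EuclideanSpace ℝ (Fin d)) (b : ℝ), a ≠ 0 ∧ ∀ i, ⟪a, p i⟫ = b)) := by
  rw [← Matrix.exists_vecMul_eq_zero_iff]
  constructor
  · rintro ⟨v, hv, h⟩
    have key := fun j => (vecMul_inSphereMatrix d p v j).symm.trans (congrFun h j)
    simp only [Pi.zero_apply] at key
    set a : EuclideanSpace ℝ (Fin d) :=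
      WithLp.toLp 2 (fun i : Fin d => v i.castSucc.castSucc) with ha
    set s := v (Fin.last d).castSucc with hs
    set t := v (Fin.last (d + 1)) with ht
    by_cases hs0 : s = 0
    · right
      refine ⟨a, -t, ?_, fun i => ?_⟩
      · intro ha0
        apply hv
        have ht0 : t = 0 := by
          have := key 0
          rw [ha0, hs0, inner_zero_left] at this
          linarith
        funext i
        refine Fin.lastCases ht0 (fun i => ?_) i
        refine Fin.lastCases hs0 (fun i => ?_) i
        have := congrArg (fun x : EuclideanSpace ℝ (Fin d) => x i) ha0
        simpa [ha] using this
      · have := key i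
        rw [hs0] at this
        linarith
    · left
      have hk : ∀ i, ‖p i - (-(1 / (2 * s))) • a‖ ^ 2 =
          -t / s + ‖(-(1 / (2 * s))) • a‖ ^ 2 := by
        intro i
        have := key i
        rw [norm_sub_sq_real, inner_smul_right, real_inner_comm]
        have h2 : ⟪a, p i⟫ = -t - s * ‖p i‖ ^ 2 := by linarith
        rw [h2]
        field_simp
        ring
      refine ⟨(-(1 / (2 * s))) • a, ‖p 0 - (-(1 / (2 * s))) • a‖, norm_nonneg _, fun i => ?_⟩
      rw [← sq_eq_sq₀ (norm_nonneg _) (norm_nonneg _), hk i, hk 0]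
  · rintro (⟨c, r, -, h⟩ | ⟨a, b, ha, h⟩)
    · refine ⟨Fin.snoc (α := fun _ => ℝ) (Fin.snoc (α := fun _ => ℝ) (fun i => -2 * c i) 1)
        (‖c‖ ^ 2 - r ^ 2), ?_, ?_⟩
      · intro h0
        have := congrFun h0 (Fin.last d).castSucc
        simp only [Fin.snoc_castSucc, Fin.snoc_last, Pi.zero_apply] at this
        exact one_ne_zero this
      · funext j
        rw [vecMul_inSphereMatrix]
        simp only [Fin.snoc_castSucc, Fin.snoc_last, Pi.zero_apply]
        have hc : (WithLp.toLp 2 (fun i : Fin d => -2 * c i) : EuclideanSpace ℝ (Fin d))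
            = (-2 : ℝ) • c := by
          ext i; simp
        rw [hc, inner_smul_left, ← h j, norm_sub_sq_real, real_inner_comm]
        simp
    · refine ⟨Fin.snoc (α := fun _ => ℝ) (Fin.snoc (α := fun _ => ℝ) (fun i => a i) 0)
        (-b), ?_, ?_⟩
      · intro h0
        apply ha
        ext i
        have := congrFun h0 i.castSucc.castSucc
        simpa only [Fin.snoc_castSucc, Pi.zero_apply, PiLp.zero_apply] using this
      · funext j
        rw [vecMul_inSphereMatrix]
        simp only [Fin.snoc_castSucc, Fin.snoc_last, Pi.zero_apply]
        have hc : (WithLp.toLp 2 (fun i : Fin d => a i) : EuclideanSpace ℝ (Fin d)) = a := rfl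
        rw [hc, h j]
        ring
end

section
/- Let p_1, …, p_{d+2} be points in ℝ^d with real weights w_1, …, w_{d+2}. Then the (d+2)×(d+2) determinant whose i-th column consists of the d coordinates of p_i, followed by ‖p_i‖² − w_i², followed by 1, is zero if and only if there exist c ∈ ℝ^d and ρ ∈ ℝ with ‖p_i − c‖² − w_i² = ρ for all i (the weighted points admit a common orthogonal ball with center c and squared orthoradius ρ), or the points p_1, …, p_{d+2} lie on a common affine hyperplane of ℝ^d. -/
open scoped RealInnerProductSpace

/-- The `(d+2) × (d+2)` matrix whose `j`-th column consists of the `d`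
coordinates of `p j`, followed by `‖p j‖² − (w j)²`, followed by `1`. -/
noncomputable def weightedInSphereMatrix (d : ℕ)
    (p : Fin (d + 2) → EuclideanSpace ℝ (Fin d)) (w : Fin (d + 2) → ℝ) :
    Matrix (Fin (d + 2)) (Fin (d + 2)) ℝ :=
  Matrix.of fun i j =>
    if h : (i : ℕ) < d then p j ⟨(i : ℕ), h⟩
    else if (i : ℕ) = d then ‖p j‖ ^ 2 - (w j) ^ 2
    else 1

/-- A left multiplication of the matrix, written out in terms of the blocks of the vector. -/
lemma vecMul_weighted (d : ℕ)
    (p : Fin (d + 2) → EuclideanSpace ℝ (Fin d)) (w : Fin (d + 2) → ℝ)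
    (v : Fin (d + 2) → ℝ) (j : Fin (d + 2)) :
    Matrix.vecMul v (weightedInSphereMatrix d p w) j =
      ⟪(WithLp.toLp 2 (fun i : Fin d => v i.castSucc.castSucc) : EuclideanSpace ℝ (Fin d)), p j⟫
        + v (Fin.last d).castSucc * (‖p j‖ ^ 2 - (w j) ^ 2) + v (Fin.last (d + 1)) := by
  simp [Matrix.vecMul, dotProduct, Fin.sum_univ_castSucc, weightedInSphereMatrix,
    PiLp.inner_apply, mul_comm]

theorem weighted_det_eq_zero_iff_common_orthoball_or_cohyperplanar
    (d : ℕ) (hd : 0 < d)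
    (p : Fin (d + 2) → EuclideanSpace ℝ (Fin d)) (w : Fin (d + 2) → ℝ) :
    (weightedInSphereMatrix d p w).det = 0 ↔
      ((∃ (c : EuclideanSpace ℝ (Fin d)) (ρ : ℝ), ∀ i, ‖p i - c‖ ^ 2 - (w i) ^ 2 = ρ) ∨
       (∃ (a : EuclideanSpace ℝ (Fin d)) (b : ℝ), a ≠ 0 ∧ ∀ i, ⟪a, p i⟫ = b)) := by
  rw [← Matrix.exists_vecMul_eq_zero_iff]
  constructor
  · rintro ⟨v, hv, h⟩
    have key := fun j => (vecMul_weighted d p w v j).symm.trans (congrFun h j)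
    simp only [Pi.zero_apply] at key
    set a : EuclideanSpace ℝ (Fin d) := WithLp.toLp 2 (fun i : Fin d => v i.castSucc.castSucc)
      with ha
    set s := v (Fin.last d).castSucc with hs
    set t := v (Fin.last (d + 1)) with ht
    by_cases hs0 : s = 0
    · right
      refine ⟨a, -t, ?_, fun i => ?_⟩
      · intro ha0
        have ht0 : t = 0 := by
          have := key 0
          rw [ha0, hs0] at this
          simpa using this
        apply hv
        funext k
        refine Fin.lastCases ht0 (fun k => ?_) k
        refine Fin.lastCases hs0 (fun k => ?_) k
        have := congrArg (fun x : EuclideanSpace ℝ (Fin d) => x k) ha0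
        simpa [ha] using this
      · have := key i
        rw [hs0] at this
        linarith
    · left
      refine ⟨(-(1 / (2 * s))) • a, ‖(-(1 / (2 * s))) • a‖ ^ 2 - t / s, fun i => ?_⟩
      have hk := key i
      rw [norm_sub_sq_real, inner_smul_right, real_inner_comm]
      field_simp
      linarith
  · rintro (⟨c, ρ, h⟩ | ⟨a, b, ha, h⟩)
    · refine ⟨Fin.snoc (α := fun _ => ℝ) (Fin.snoc (α := fun _ => ℝ) (fun i => ((-2 : ℝ) • c) i) 1)
        (‖c‖ ^ 2 - ρ), fun h0 => ?_, ?_⟩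
      · have := congrFun h0 (Fin.last d).castSucc
        simp at this
      · funext j
        rw [vecMul_weighted]
        have hj := h j
        rw [norm_sub_sq_real, real_inner_comm] at hj
        simp only [Fin.snoc_castSucc, Fin.snoc_last, WithLp.toLp_ofLp, Pi.zero_apply]
        rw [real_inner_smul_left]
        linarith
    · refine ⟨Fin.snoc (α := fun _ => ℝ) (Fin.snoc (α := fun _ => ℝ) (fun i => a i) 0)
        (-b), fun h0 => ha ?_, ?_⟩
      · ext k
        have := congrFun h0 k.castSucc.castSucc
        simpa using this
      · funext j
        rw [vecMul_weighted]
        simp only [Fin.snoc_castSucc, Fin.snoc_last, WithLp.toLp_ofLp, Pi.zero_apply]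
        rw [h j]
        ring
end
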